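/- Let χ be a primitive Dirichlet character (mod n), let f be an even function (mod n), and let s be an integer. Then Σ_{k=1}^{n} f(k − s) χ(k) = (μ∗f)(n) · χ(s). -/

import Mathlib

open Finset ArithmeticFunction

/-- Summing a function on `ZMod n` over the representatives `1, …, n`. -/
theorem ZMod.sum_Icc_natCast {M : Type*} [AddCommMonoid M] (n : ℕ) [NeZero n] (φ : ZMod n → M) :
    ∑ k ∈ Finset.Icc 1 n, φ (k : ZMod n) = ∑ x : ZMod n, φ x := by
  have hinj : Set.InjOn (fun k : ℕ => (k : ZMod n)) (Finset.Icc 1 n : Finset ℕ) := by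
    intro a ha b hb hab
    simp only [Finset.coe_Icc, Set.mem_Icc] at ha hb
    have h : (n : ℤ) ∣ (b : ℤ) - a :=
      (Nat.modEq_iff_dvd).1 ((ZMod.natCast_eq_natCast_iff a b n).1 hab)
    have := Int.eq_zero_of_abs_lt_dvd h (by rw [abs_lt]; omega)
    omega
  rw [← Finset.sum_image (f := φ) (g := fun k : ℕ => (k : ZMod n)) hinj]
  congr 1
  apply Finset.eq_univ_of_card
  rw [Finset.card_image_of_injOn hinj, ZMod.card, Nat.card_Icc, Nat.add_sub_cancel]

/-- A primitive character sums to zero over each residue class modulo a proper divisor of its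
modulus. -/
theorem DirichletCharacter.IsPrimitive.sum_castHom_eq_zero {R : Type*} [CommRing R] [IsDomain R]
    {n d : ℕ} [NeZero n] {χ : DirichletCharacter R n} (hχ : χ.IsPrimitive) (hd : d ∣ n)
    (hdn : d ≠ n) (t : ZMod d) :
    ∑ x : ZMod n, (if ZMod.castHom hd (ZMod d) x = t then χ x else 0) = 0 := by
  have hnot : ¬ χ.FactorsThrough d := fun h => by
    have h1 : χ.conductor ∣ d := χ.conductor_dvd_of_mem_conductorSet h
    rw [(DirichletCharacter.isPrimitive_def χ).1 hχ] at h1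
    exact hdn (Nat.dvd_antisymm hd h1)
  rw [DirichletCharacter.factorsThrough_iff_ker_unitsMap hd, SetLike.not_le_iff_exists] at hnot
  obtain ⟨u, hu, hχu⟩ := hnot
  have hu1 : ZMod.castHom hd (ZMod d) (u : ZMod n) = 1 :=
    congrArg Units.val (MonoidHom.mem_ker.1 hu)
  have hχu1 : χ (u : ZMod n) ≠ 1 := fun h => hχu <| by
    rw [MonoidHom.mem_ker]
    ext
    simpa using h
  set S := ∑ x : ZMod n, (if ZMod.castHom hd (ZMod d) x = t then χ x else 0) with hS
  have key : S = χ (u : ZMod n) * S := by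
    conv_lhs => rw [hS]
    rw [← Equiv.sum_comp u.mulLeft, hS, Finset.mul_sum]
    refine Finset.sum_congr rfl fun x _ => ?_
    rw [Units.mulLeft_apply, map_mul, map_mul, hu1, one_mul, mul_ite, mul_zero]
  have h0 : (χ (u : ZMod n) - 1) * S = 0 := by rw [sub_mul, one_mul, ← key, sub_self]
  exact (mul_eq_zero.1 h0).resolve_left (sub_ne_zero.2 hχu1)

/-- **Theorem (primitive character case)**.  Let `χ` be a primitive Dirichlet character
(mod `n`), let `f` be an even function (mod `n`), and let `s` be an integer.  Then
`∑_{k=1}^{n} f (k - s) χ(k) = (μ∗f)(n) · χ(s)`. -/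
theorem menon_primitive_character_even (n : ℕ) (hn : 0 < n)
    (χ : DirichletCharacter ℂ n) (hprim : χ.IsPrimitive)
    (f : ℤ → ℂ) (hf : ∀ k : ℤ, f ((Int.gcd k (n : ℤ) : ℕ) : ℤ) = f k) (s : ℤ) :
    ∑ k ∈ Finset.Icc 1 n, f ((k : ℤ) - s) * χ (k : ZMod n)
      = (∑ a ∈ n.divisors, (moebius a : ℂ) * f ((n / a : ℕ) : ℤ)) * χ ((s : ℤ) : ZMod n) := by
  have : NeZero n := ⟨hn.ne'⟩
  set G : ℕ → ℂ := fun m => ∑ x ∈ m.divisorsAntidiagonal, (moebius x.1 : ℂ) * f (x.2 : ℤ) with hG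
  have hinv : ∀ m : ℕ, m > 0 → ∑ d ∈ Nat.divisors m, G d = f (m : ℤ) :=
    (ArithmeticFunction.sum_eq_iff_sum_mul_moebius_eq (g := fun m : ℕ => f (m : ℤ))).2
      fun _ _ => rfl
  have hGn : ∑ a ∈ n.divisors, (moebius a : ℂ) * f ((n / a : ℕ) : ℤ) = G n :=
    (Nat.sum_divisorsAntidiagonal fun a b => (moebius a : ℂ) * f (b : ℤ)).symm
  have hfk : ∀ m : ℤ, f m = ∑ d ∈ n.divisors, if (d : ℤ) ∣ m then G d else 0 := fun m => by
    rw [← hf m, ← hinv _ (Int.gcd_pos_of_ne_zero_right m (by exact_mod_cast hn.ne')),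
      ← Finset.sum_filter]
    refine Finset.sum_congr ?_ fun _ _ => rfl
    ext d
    have hgcd : Int.gcd m n ≠ 0 :=
      (Int.gcd_pos_of_ne_zero_right m (by exact_mod_cast hn.ne')).ne'
    simp only [Nat.mem_divisors, Finset.mem_filter, Int.natCast_dvd_natCast,
      ← Int.natCast_dvd_natCast (n := Int.gcd m n), Int.dvd_coe_gcd_iff]
    have := hn.ne'
    tauto
  have hinner : ∀ d (hd : d ∣ n),
      ∑ k ∈ Finset.Icc 1 n, (if (d : ℤ) ∣ (k : ℤ) - s then χ (k : ZMod n) else 0)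
        = ∑ x : ZMod n, (if ZMod.castHom hd (ZMod d) x = (s : ZMod d) then χ x else 0) :=
    fun d hd => by
      rw [← ZMod.sum_Icc_natCast]
      refine Finset.sum_congr rfl fun k _ => ?_
      refine if_congr ?_ rfl rfl
      rw [map_natCast, ← ZMod.intCast_zmod_eq_zero_iff_dvd, Int.cast_sub, Int.cast_natCast,
        sub_eq_zero]
  calc ∑ k ∈ Finset.Icc 1 n, f ((k : ℤ) - s) * χ (k : ZMod n)
      = ∑ d ∈ n.divisors, G d *
          ∑ k ∈ Finset.Icc 1 n, (if (d : ℤ) ∣ (k : ℤ) - s then χ (k : ZMod n) else 0) := by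
        simp_rw [Finset.mul_sum]
        rw [Finset.sum_comm]
        refine Finset.sum_congr rfl fun k _ => ?_
        rw [hfk, Finset.sum_mul]
        refine Finset.sum_congr rfl fun d _ => ?_
        split_ifs <;> simp
    _ = G n * χ (s : ZMod n) := by
        rw [Finset.sum_eq_single_of_mem n (Nat.mem_divisors_self n hn.ne')]
        · rw [hinner n dvd_rfl]
          simp
        · intro d hd hdn
          rw [hinner d (Nat.dvd_of_mem_divisors hd), hprim.sum_castHom_eq_zero _ hdn, mul_zero]
    _ = _ := by rw [hGn]
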